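/- arXiv:2410.22181 — 9 statements merged into one kernel-verified Lean document; each statement's English description precedes it below -/
import Mathlib

section
/- Let S be a biEhresmann semigroup and s ∈ S. Then s is deterministic (i.e., e·s = s·(e·s)* for all projections e) if and only if for all t ∈ S, t ≤' s implies t ≤ s. -/
/-- In a biEhresmann semigroup, `s` is deterministic
(`e·s = s·(e·s)*` for all projections `e`) iff for all `t`, `t ≤' s` implies `t ≤ s`,
where `t ≤' s` means `t = t⁺·s` and `t ≤ s` means `t = s·t*`. -/
theorem deterministic_iff_le'_implies_le {S : Type*} [Semigroup S] (star p : S → S)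
    -- Ehresmann axioms for *
    (h1 : ∀ x, x * star x = x)
    (h2 : ∀ x y, star x * star y = star y * star x)
    (h3 : ∀ x y, star y * star x = star (star x * star y))
    (h4 : ∀ x y, star (x * y) = star (star x * y))
    -- coEhresmann axioms for p
    (p1 : ∀ x, p x * x = x)
    (p2 : ∀ x y, p x * p y = p y * p x)
    (p3 : ∀ x y, p y * p x = p (p x * p y))
    (p4 : ∀ x y, p (x * y) = p (x * p y))
    -- compatibility
    (cp1 : ∀ x, star (p x) = p x)
    (cp2 : ∀ x, p (star x) = star x)
    (s : S) :
    (∀ e, (∃ a, star a = e) → e * s = s * star (e * s)) ↔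
      (∀ t, t = p t * s → t = s * star t) := by
  constructor
  · intro h t ht
    have := h (p t) ⟨p t, cp1 t⟩
    rwa [← ht] at this
  · rintro h e ⟨a, rfl⟩
    apply h
    have hp : p (star a * s) = star a * p s := by
      rw [p4, ← cp2 a, ← p3, p2]
    rw [hp, mul_assoc, p1]
end

section
/- Let S be a biEhresmann semigroup and let BD(S) be its set of bideterministic elements. Then BD(S) contains all projections, is closed under the multiplication and the operations * and +, and for all s, t ∈ BD(S) the identities s*·t = t·(s·t)* and s·t+ = (s·t)+·s hold; in particular, BD(S) is a birestriction semigroup whose set of projections coincides with P(S). -/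
/-- An element `a` is deterministic: `e·a = a·(e·a)*` for all projections `e`. -/
def IsDeterministic {S : Type*} [Semigroup S] (star : S → S) (a : S) : Prop :=
  ∀ e, (∃ x, star x = e) → e * a = a * star (e * a)

/-- An element `a` is codeterministic: `a·e = (a·e)⁺·a` for all projections `e`. -/
def IsCodeterministic {S : Type*} [Semigroup S] (star p : S → S) (a : S) : Prop :=
  ∀ e, (∃ x, star x = e) → a * e = p (a * e) * a

/-- An element is bideterministic if it is both deterministic and codeterministic. -/
def IsBideterministic {S : Type*} [Semigroup S] (star p : S → S) (a : S) : Prop :=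
  IsDeterministic star a ∧ IsCodeterministic star p a

/-- In a biEhresmann semigroup, the set `BD (S)` of bideterministic
elements contains all projections, is closed under multiplication, `*` and `⁺`,
satisfies the birestriction identities, and its projections coincide with `P(S)`. -/
theorem bideterministic_birestriction {S : Type*} [Semigroup S] (star p : S → S)
    -- Ehresmann axioms for *
    (h1 : ∀ x, x * star x = x)
    (h2 : ∀ x y, star x * star y = star y * star x)
    (h3 : ∀ x y, star y * star x = star (star x * star y))
    (h4 : ∀ x y, star (x * y) = star (star x * y))
    -- coEhresmann axioms for p
    (p1 : ∀ x, p x * x = x)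
    (p2 : ∀ x y, p x * p y = p y * p x)
    (p3 : ∀ x y, p y * p x = p (p x * p y))
    (p4 : ∀ x y, p (x * y) = p (x * p y))
    -- compatibility
    (cp1 : ∀ x, star (p x) = p x)
    (cp2 : ∀ x, p (star x) = star x) :
    (∀ e, (∃ x, star x = e) → IsBideterministic star p e) ∧
    (∀ s t, IsBideterministic star p s → IsBideterministic star p t →
      IsBideterministic star p (s * t)) ∧
    (∀ s, IsBideterministic star p s → IsBideterministic star p (star s)) ∧
    (∀ s, IsBideterministic star p s → IsBideterministic star p (p s)) ∧
    (∀ s t, IsBideterministic star p s → IsBideterministic star p t →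
      star s * t = t * star (s * t)) ∧
    (∀ s t, IsBideterministic star p s → IsBideterministic star p t →
      s * p t = p (s * t) * s) ∧
    ({e | ∃ t, IsBideterministic star p t ∧ star t = e} = {e | ∃ x, star x = e}) := by
  have ss : ∀ x, star (star x) = star x := fun x => by
    have h := cp1 (star x)
    rwa [cp2] at h
  have idem : ∀ x, star x * star x = star x := fun x => by
    have h := h1 (star x)
    rwa [ss] at h
  have st : ∀ x y, star (star x * star y) = star x * star y := fun x y => by
    rw [← h3, h2]
  have pst : ∀ x y, p (star x * star y) = star x * star y := fun x y => by
    rw [← st, cp2]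
  have proj : ∀ e, (∃ x, star x = e) → IsBideterministic star p e := by
    rintro _ ⟨x, rfl⟩
    constructor
    · rintro _ ⟨y, rfl⟩
      rw [st, h2 y x, ← mul_assoc, idem]
    · rintro _ ⟨y, rfl⟩
      rw [pst, h2 x y, mul_assoc, idem]
  refine ⟨proj, ?_, fun s _ => proj _ ⟨s, rfl⟩, fun s _ => proj _ ⟨p s, cp1 s⟩, ?_, ?_, ?_⟩
  · rintro s t ⟨hs, hs'⟩ ⟨ht, ht'⟩
    constructor
    · intro e he
      have a := ht (star (e * s)) ⟨_, rfl⟩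
      rw [← h4] at a
      calc e * (s * t) = s * star (e * s) * t := by rw [← mul_assoc, ← hs e he]
        _ = s * t * star (e * (s * t)) := by rw [mul_assoc, a, ← mul_assoc, mul_assoc e]
    · intro e he
      have a := hs' (p (t * e)) ⟨_, cp1 _⟩
      rw [← p4] at a
      calc s * t * e = s * (p (t * e) * t) := by rw [mul_assoc, ← ht' e he]
        _ = p (s * t * e) * (s * t) := by rw [← mul_assoc, a, mul_assoc, mul_assoc s t e]
  · rintro s t - ⟨ht, -⟩
    rw [h4]
    exact ht _ ⟨s, rfl⟩
  · rintro s t ⟨-, hs⟩ -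
    rw [p4]
    exact hs _ ⟨_, cp1 t⟩
  · ext e
    constructor
    · rintro ⟨t, -, h⟩
      exact ⟨t, h⟩
    · rintro ⟨x, rfl⟩
      exact ⟨star x, proj _ ⟨x, rfl⟩, ss x⟩
end

section
/- Let S be a restriction semigroup. If s and t are partial isomorphisms of S, then their product s·t is a partial isomorphism of S. -/
/-- In a restriction semigroup, the product of two partial
isomorphisms is a partial isomorphism. -/
theorem partial_isomorphisms_closed_under_mul {S : Type*} [Semigroup S] (star : S → S)
    (h1 : ∀ x, x * star x = x)
    (h2 : ∀ x y, star x * star y = star y * star x)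
    (h3 : ∀ x y, star y * star x = star (star x * star y))
    (h4 : ∀ x y, star (x * y) = star (star x * y))
    (h5 : ∀ x y, star x * y = y * star (x * y))
    (s t : S)
    (hs : ∃ a, s * a = star a ∧ a * s = star s)
    (ht : ∃ b, t * b = star b ∧ b * t = star t) :
    ∃ c, (s * t) * c = star c ∧ c * (s * t) = star (s * t) := by
  obtain ⟨a, ha1, ha2⟩ := hs
  obtain ⟨b, hb1, hb2⟩ := ht
  have key : ∀ x y, star y * star (x * y) = star (x * y) := by
    intro x y
    have h := h4 (x * y) (star y)
    rw [mul_assoc, h1, ← h3] at h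
    exact h.symm
  refine ⟨b * a, ?_, ?_⟩
  · calc s * t * (b * a) = s * ((t * b) * a) := by simp only [mul_assoc]
      _ = star (b * a) := by rw [hb1, h5, ← mul_assoc, ha1, key]
  · calc b * a * (s * t) = b * ((a * s) * t) := by simp only [mul_assoc]
      _ = star (s * t) := by rw [ha2, h5, ← mul_assoc, hb2, key]
end

section
/- Let S be a range semigroup and let s ∈ S be a partial isomorphism with partial inverse s'. Then s+ = (s')*. -/
/-- In a range semigroup, if `s` is a partial isomorphism with
partial inverse `s'`, then `s⁺ = (s')*`. -/
theorem range_semigroup_plus_eq_star_of_inverse {S : Type*} [Semigroup S]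
    (star p : S → S)
    -- Ehresmann axioms for *
    (h1 : ∀ x, x * star x = x)
    (h2 : ∀ x y, star x * star y = star y * star x)
    (h3 : ∀ x y, star y * star x = star (star x * star y))
    (h4 : ∀ x y, star (x * y) = star (star x * y))
    -- restriction identity
    (h5 : ∀ x y, star x * y = y * star (x * y))
    -- coEhresmann axioms for p
    (p1 : ∀ x, p x * x = x)
    (p2 : ∀ x y, p x * p y = p y * p x)
    (p3 : ∀ x y, p y * p x = p (p x * p y))
    (p4 : ∀ x y, p (x * y) = p (x * p y))
    -- compatibility
    (cp1 : ∀ x, star (p x) = p x)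
    (cp2 : ∀ x, p (star x) = star x)
    (s s' : S)
    (hi1 : s * s' = star s') (hi2 : s' * s = star s) :
    p s = star s' := by
  have a : star s' * s = s := by rw [← hi1, mul_assoc, hi2, h1]
  have b : p s * star s' = star s' := by rw [← hi1, ← mul_assoc, p1]
  have c : p s = p s * star s' := by
    calc p s = p (star s' * s) := by rw [a]
      _ = p (star s' * p s) := p4 _ _
      _ = p (p (star s') * p s) := by rw [cp2]
      _ = p s * p (star s') := (p3 _ _).symm
      _ = p s * star s' := by rw [cp2]
  exact c.trans b
end

section
/- Let S be a range semigroup and let s ∈ S be a partial isomorphism. Then s is bideterministic; in particular, s·e = (s·e)+·s for every projection e. -/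
/-- In a range semigroup, a partial isomorphism `s` is
bideterministic; in particular `s·e = (s·e)⁺·s` for every projection `e`. -/
theorem range_semigroup_partial_iso_bideterministic {S : Type*} [Semigroup S]
    (star p : S → S)
    -- Ehresmann axioms for *
    (h1 : ∀ x, x * star x = x)
    (h2 : ∀ x y, star x * star y = star y * star x)
    (h3 : ∀ x y, star y * star x = star (star x * star y))
    (h4 : ∀ x y, star (x * y) = star (star x * y))
    -- restriction identity
    (h5 : ∀ x y, star x * y = y * star (x * y))
    -- coEhresmann axioms for p
    (p1 : ∀ x, p x * x = x)
    (p2 : ∀ x y, p x * p y = p y * p x)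
    (p3 : ∀ x y, p y * p x = p (p x * p y))
    (p4 : ∀ x y, p (x * y) = p (x * p y))
    -- compatibility
    (cp1 : ∀ x, star (p x) = p x)
    (cp2 : ∀ x, p (star x) = star x)
    (s : S)
    (hs : ∃ t, s * t = star t ∧ t * s = star s) :
    (∀ e, (∃ x, star x = e) → e * s = s * star (e * s)) ∧
    (∀ e, (∃ x, star x = e) → s * e = p (s * e) * s) := by
  obtain ⟨t, ht1, ht2⟩ := hs
  constructor
  · rintro e ⟨x, rfl⟩
    rw [← h4]; exact h5 x s
  · rintro e ⟨x, rfl⟩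
    have hf : s * star x * t = star (star (x * t) * star t) := by
      rw [mul_assoc, h5 x t, ← mul_assoc, ht1]
      exact h3 _ _
    have hse : s * star x = star (star (x * t) * star t) * s := by
      rw [← hf, mul_assoc, ht2, mul_assoc, h2 x s, ← mul_assoc, h1]
    generalize star (x * t) * star t = g at hse
    have hp : p (s * star x) = star g * p s := by
      rw [hse, p4]
      have := p3 (star g) s
      rw [cp2] at this
      rw [← this]
      have := p2 s (star g)
      rwa [cp2] at this
    rw [hp, mul_assoc, p1, hse]
end

section
/- Let S be a restriction semigroup and let s, t ∈ S be such that the joins s∨t and s*∨t* (least upper bounds with respect to the natural partial order ≤) exist in S. Then (s∨t)* = s*∨t*. -/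
/-- The natural partial order of an Ehresmann semigroup: `s ≤ t` iff `s = t·s*`. -/
def NatLe {S : Type*} [Semigroup S] (star : S → S) (s t : S) : Prop :=
  s = t * star s

/-- `j` is the join (least upper bound w.r.t. the natural partial order)
of `s` and `t`. -/
def IsJoin {S : Type*} [Semigroup S] (star : S → S) (j s t : S) : Prop :=
  NatLe star s j ∧ NatLe star t j ∧ ∀ u, NatLe star s u → NatLe star t u → NatLe star j u

/-- In a restriction semigroup, if the joins `s ∨ t` and `s* ∨ t*`
exist, then `(s ∨ t)* = s* ∨ t*`. -/
theorem star_of_join {S : Type*} [Semigroup S] (star : S → S)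
    (h1 : ∀ x, x * star x = x)
    (h2 : ∀ x y, star x * star y = star y * star x)
    (h3 : ∀ x y, star y * star x = star (star x * star y))
    (h4 : ∀ x y, star (x * y) = star (star x * y))
    (h5 : ∀ x y, star x * y = y * star (x * y))
    (s t j k : S)
    (hj : IsJoin star j s t)
    (hk : IsJoin star k (star s) (star t)) :
    star j = k := by
  unfold IsJoin NatLe at *
  obtain ⟨a1, a2, a3⟩ := hj
  obtain ⟨b1, b2, b3⟩ := hk
  have idem : ∀ x, star x * star x = star x := by
    intro x
    have e := h4 x (star x)
    rw [h1, ← h3] at e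
    exact e.symm
  have ss : ∀ x, star (star x) = star x := by
    intro x
    have e := h3 x x
    rw [idem] at e
    exact e.symm
  have key : ∀ x, x = j * star x → star x = star j * star x := by
    intro x hx
    have e := h4 j (star x)
    rw [← hx, ← h3, h2] at e
    exact e
  have hkj := b3 (star j) (by rw [ss]; exact key s a1) (by rw [ss]; exact key t a2)
  have hks : star k = k := by
    have e2 := h3 k j
    rw [← hkj, h2 k j, ← hkj] at e2
    exact e2.symm
  rw [hks] at hkj
  rw [ss] at b1 b2
  have hjk := a3 (j * k) (by rw [mul_assoc, ← b1]; exact a1) (by rw [mul_assoc, ← b2]; exact a2)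
  have hc : k * star j = k := by
    have e := h2 k j
    rw [hks, ← hkj] at e
    exact e
  rw [mul_assoc, hc] at hjk
  have e := h4 j k
  rw [← hjk, ← hkj, hks] at e
  exact e
end

section
/- Let S be a restriction semigroup, let e, f ∈ P(S) be projections and s ∈ S with e ≤ s* and f ≤ s*, and suppose the joins e∨f and (s·e)∨(s·f) (least upper bounds with respect to ≤) exist in S. Then (s·e)∨(s·f) = s·(e∨f). -/
/-- In a restriction semigroup, if `e, f` are projections with
`e, f ≤ s*` and the joins `e ∨ f` and `(s·e) ∨ (s·f)` exist, then
`(s·e) ∨ (s·f) = s·(e ∨ f)`. -/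
theorem join_of_translates {S : Type*} [Semigroup S] (star : S → S)
    (h1 : ∀ x, x * star x = x)
    (h2 : ∀ x y, star x * star y = star y * star x)
    (h3 : ∀ x y, star y * star x = star (star x * star y))
    (h4 : ∀ x y, star (x * y) = star (star x * y))
    (h5 : ∀ x y, star x * y = y * star (x * y))
    (e f s j k : S)
    (he : ∃ a, star a = e) (hf : ∃ a, star a = f)
    (hes : NatLe star e (star s)) (hfs : NatLe star f (star s))
    (hj : IsJoin star j e f)
    (hk : IsJoin star k (s * e) (s * f)) :
    k = s * j := by
  have idem : ∀ x, star x * star x = star x := fun x => by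
    have := h4 x (star x)
    rw [h1, ← h3] at this
    exact this.symm
  have ss : ∀ x, star (star x) = star x := fun x => by
    conv_lhs => rw [← idem x]
    rw [← h3, idem]
  obtain ⟨a, rfl⟩ := he
  obtain ⟨b, rfl⟩ := hf
  obtain ⟨hj1, hj2, hj3⟩ := hj
  obtain ⟨hk1, hk2, hk3⟩ := hk
  have hjs := hj3 _ hes hfs
  unfold NatLe at *
  rw [ss] at hes hfs hj1 hj2
  have hjj : star j = j := by
    have : star j = star (star s * star j) := congrArg star hjs
    rw [← h3, h2, ← hjs] at this
    exact this
  have hsa : star (s * star a) = star a := by rw [h4, ← hes, ss]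
  have hsb : star (s * star b) = star b := by rw [h4, ← hfs, ss]
  rw [hsa] at hk1 hk3
  rw [hsb] at hk2 hk3
  have hkk := hk3 (s * j) (by rw [mul_assoc, ← hj1]) (by rw [mul_assoc, ← hj2])
  have ha : star a = star k * star (star a) := by
    have := congrArg star hk1
    rw [hsa, h4, ← h3, h2] at this
    rw [ss]; exact this
  have hb : star b = star k * star (star b) := by
    have := congrArg star hk2
    rw [hsb, h4, ← h3, h2] at this
    rw [ss]; exact this
  have hjk := hj3 (star k) ha hb
  rw [h2, hjj] at hjk
  rw [hkk, mul_assoc, ← hjk]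
end

section
/- Let S be a preBoolean restriction semigroup and let s, t, u ∈ S be such that the join s∨t exists. Then the join (u·s)∨(u·t) exists and (u·s)∨(u·t) = u·(s∨t). -/
/-- In a preBoolean restriction semigroup, if `s ∨ t` exists
then `(u·s) ∨ (u·t)` exists and equals `u·(s ∨ t)`. -/
theorem preBoolean_left_distributivity {S : Type*} [Semigroup S] (star : S → S) (z : S)
    -- Ehresmann axioms
    (h1 : ∀ x, x * star x = x)
    (h2 : ∀ x y, star x * star y = star y * star x)
    (h3 : ∀ x y, star y * star x = star (star x * star y))
    (h4 : ∀ x y, star (x * y) = star (star x * y))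
    -- restriction identity
    (h5 : ∀ x y, star x * y = y * star (x * y))
    -- z is a left zero and a projection
    (hz : ∀ s, z * s = z) (hzp : star z = z)
    -- (BR1') elements with a common upper bound have a join
    (br1 : ∀ s t u : S, NatLe star s u → NatLe star t u → ∃ j, IsJoin star j s t)
    -- (BR2) the projections form a generalized Boolean algebra:
    -- binary joins of projections exist in S and are projections,
    (br2_join : ∀ e f : S, (∃ a, star a = e) → (∃ a, star a = f) →
      ∃ j, (∃ a, star a = j) ∧ IsJoin star j e f)
    -- the meet (product) distributes over joins of projections,
    (br2_distrib : ∀ e f g j : S, (∃ a, star a = e) → (∃ a, star a = f) →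
      (∃ a, star a = g) → IsJoin star j f g → IsJoin star (e * j) (e * f) (e * g))
    -- and relative complements exist: if `e ≤ f`, there is `g` with
    -- `e·g = 0` and `e ∨ g = f`.
    (br2_relcompl : ∀ e f : S, (∃ a, star a = e) → (∃ a, star a = f) →
      NatLe star e f → ∃ g, (∃ a, star a = g) ∧ e * g = z ∧ IsJoin star f e g)
    -- (BR3) multiplication distributes over joins from the right
    (br3 : ∀ s t j u : S, IsJoin star j s t → IsJoin star (j * u) (s * u) (t * u)) :
    ∀ s t u j : S, IsJoin star j s t → IsJoin star (u * j) (u * s) (u * t) := by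
  intro s t u j hj
  have idem : ∀ x, star x * star x = star x := fun x => by
    rw [h3, ← h4, h1]
  have ss : ∀ x, star (star x) = star x := fun x => by
    have := h3 x x
    rw [idem] at this
    exact this.symm
  -- star of a product with a projection
  have sp : ∀ a x, star (a * star x) = star a * star x := fun a x => by
    rw [h4, ← h3, h2]
  obtain ⟨hs, ht, hmin⟩ := hj
  unfold NatLe at hs ht
  have hus : star (u * s) = star (u * j) * star s := by
    rw [← sp, mul_assoc, ← hs]
  have hut : star (u * t) = star (u * j) * star t := by
    rw [← sp, mul_assoc, ← ht]
  have les : NatLe star (u * s) (u * j) := by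
    unfold NatLe
    rw [hus, ← mul_assoc, h1, mul_assoc, ← hs]
  have let' : NatLe star (u * t) (u * j) := by
    unfold NatLe
    rw [hut, ← mul_assoc, h1, mul_assoc, ← ht]
  obtain ⟨k, hk⟩ := br1 _ _ _ les let'
  obtain ⟨_, ⟨a, rfl⟩, he⟩ := br2_join (star s) (star t) ⟨s, rfl⟩ ⟨t, rfl⟩
  have e1 : star s = star a * star s := by
    have := he.1
    unfold NatLe at this
    rwa [ss] at this
  have e2 : star t = star a * star t := by
    have := he.2.1
    unfold NatLe at this
    rwa [ss] at this
  have hja : j = j * star a := by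
    have h : j = j * star a * star j := hmin (j * star a)
      (by unfold NatLe; rw [mul_assoc, ← e1, ← hs])
      (by unfold NatLe; rw [mul_assoc, ← e2, ← ht])
    rwa [mul_assoc, h2, ← mul_assoc, h1] at h
  have hd := br2_distrib (star (u * j)) _ _ _ ⟨_, rfl⟩ ⟨s, rfl⟩ ⟨t, rfl⟩ he
  rw [← hus, ← hut, ← sp, mul_assoc, ← hja] at hd
  have mono : ∀ x y, NatLe star x y → star x = star y * star x := fun x y h => by
    unfold NatLe at h
    conv_lhs => rw [h]
    rw [sp]
  have hle : star (u * j) = star k * star (u * j) := by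
    have := hd.2.2 (star k)
      (by unfold NatLe; rw [ss]; exact mono _ _ hk.1)
      (by unfold NatLe; rw [ss]; exact mono _ _ hk.2.1)
    unfold NatLe at this
    rwa [ss] at this
  have hkle : NatLe star k (u * j) := hk.2.2 _ les let'
  have hk2 := mono _ _ hkle
  have heq : star k = star (u * j) := by rw [hk2, h2, ← hle]
  have : k = u * j := by
    unfold NatLe at hkle
    rw [heq, h1] at hkle
    exact hkle
  rw [← this]
  exact hk
end

section
/- Let C = (C1, C0, u, d, r, m) be an étale topological category. Then the multiplication map m : C2 → C1 is an open map, where C2 = {(x,y) ∈ C1 × C1 : r(y) = d(x)} carries the subspace topology from C1 × C1. -/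
/-- In an étale topological category, the multiplication map
`m : C₂ → C₁` is an open map (with `C₂` carrying the subspace topology). -/
theorem etale_category_mul_open
    {C1 C0 : Type*} [TopologicalSpace C1] [TopologicalSpace C0]
    -- C0 is a locally compact Hausdorff space
    [T2Space C0] [LocallyCompactSpace C0]
    (u : C0 → C1) (d r : C1 → C0)
    (m : {p : C1 × C1 // r p.2 = d p.1} → C1)
    -- continuity of the structure maps
    (hu : Continuous u) (hd : Continuous d) (hr : Continuous r)
    (hm : Continuous m)
    -- (DRU) domain and range of a unit
    (hdu : ∀ x, d (u x) = x) (hru : ∀ x, r (u x) = x)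
    -- (DP) and (RP) domain and range of a product
    (hdm : ∀ q, d (m q) = d q.1.2) (hrm : ∀ q, r (m q) = r q.1.1)
    -- (A) associativity
    (hassoc : ∀ (x y z : C1) (hxy : r y = d x) (hyz : r z = d y),
      m ⟨(m ⟨(x, y), hxy⟩, z), by rw [hdm]; exact hyz⟩ =
      m ⟨(x, m ⟨(y, z), hyz⟩), by rw [hrm]; exact hxy⟩)
    -- (UL) left and right unit laws
    (hul : ∀ x : C1, m ⟨(u (r x), x), (hdu (r x)).symm⟩ = x)
    (hur : ∀ x : C1, m ⟨(x, u (d x)), hru (d x)⟩ = x)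
    -- étale: the domain map is a local homeomorphism
    (hetale : IsLocalHomeomorph d) :
    IsOpenMap m := by
  have hp : IsOpenMap (fun q : {p : C1 × C1 // r p.2 = d p.1} => q.1.2) := by
    rw [isOpenMap_iff_nhds_le]
    rintro ⟨⟨x, y⟩, hxy⟩ S hS
    rw [Filter.mem_map, nhds_subtype_eq_comap, Filter.mem_comap] at hS
    obtain ⟨T, hT, hTS⟩ := hS
    obtain ⟨e, hxe, rfl⟩ := hetale x
    have hxy' : r y = e x := hxy
    have hry : r y ∈ e.target := by rw [hxy']; exact e.map_source hxe
    have hc : Filter.Tendsto (fun y' => (e.symm (r y'), y')) (nhds y) (nhds (x, y)) := by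
      refine Filter.Tendsto.prodMk_nhds ?_ Filter.tendsto_id
      have h1 := (e.continuousAt_symm hry).tendsto.comp hr.continuousAt.tendsto
      rw [hxy', e.left_inv hxe] at h1
      exact h1
    have h2 : ∀ᶠ y' in nhds y, r y' ∈ e.target :=
      hr.continuousAt.eventually (e.open_target.mem_nhds hry)
    filter_upwards [h2, hc hT] with y' h3 h4
    exact hTS (a := ⟨(e.symm (r y'), y'), (e.right_inv h3).symm⟩) h4
  have hdmo : IsOpenMap (d ∘ m) := by
    have : d ∘ m = d ∘ (fun q : {p : C1 × C1 // r p.2 = d p.1} => q.1.2) := funext hdm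
    rw [this]
    exact hetale.isOpenMap.comp hp
  rw [isOpenMap_iff_nhds_le]
  intro q
  obtain ⟨e, hqe, he⟩ := hetale (m q)
  have h1 : (e.symm ∘ (d ∘ m)) =ᶠ[nhds q] m := by
    filter_upwards [hm.continuousAt.eventually (e.open_source.mem_nhds hqe)] with q' hq'
    simp only [Function.comp, he]
    exact e.left_inv hq'
  have h2 := e.symm.map_nhds_eq (x := e (m q)) (e.map_source hqe)
  rw [e.left_inv hqe] at h2
  rw [← h2, ← Filter.map_congr h1, ← Filter.map_map]
  have h3 := hdmo.nhds_le q
  simp only [Function.comp_apply, he] at h3 ⊢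
  exact Filter.map_mono h3
end
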